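/- arXiv:2006.00565 — 3 statements merged into one kernel-verified Lean document; each statement's English description precedes it below -/
import Mathlib

section
/- As n → ∞, the n-th coefficient of v²/((1-v)(1+v)²(1+v+v²)), viewed as a power series in z via z = v/(1+v+v²) (with v = (1-z-√(1-2z-3z²))/(2z)), is asymptotic to (√3/36)·3ⁿ/√(πn). -/
open Filter Real

/-- `v(z) = (1-z-√(1-2z-3z²))/(2z)`. -/
noncomputable def Vfun (z : ℝ) : ℝ := (1 - z - Real.sqrt (1 - 2 * z - 3 * z ^ 2)) / (2 * z)

/-- The coefficients of `(1 - x)^(-1/2)`, that is `centralBinom n / 4 ^ n`. -/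
noncomputable def invSqrtCoeff (n : ℕ) : ℝ :=
  ∏ i ∈ Finset.range n, ((2 * i + 1 : ℝ) / (2 * i + 2))

theorem invSqrtCoeff_succ (n : ℕ) :
    invSqrtCoeff (n + 1) = invSqrtCoeff n * ((2 * n + 1) / (2 * n + 2)) :=
  Finset.prod_range_succ _ _

theorem invSqrtCoeff_pos (n : ℕ) : 0 < invSqrtCoeff n :=
  Finset.prod_pos fun _ _ => by positivity

theorem invSqrtCoeff_le_one (n : ℕ) : invSqrtCoeff n ≤ 1 :=
  Finset.prod_le_one (fun _ _ => by positivity) fun i _ => by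
    rw [div_le_one (by positivity)]; linarith

theorem invSqrtCoeff_le_two_pow_mul (n k : ℕ) :
    invSqrtCoeff n ≤ 2 ^ k * invSqrtCoeff (n + k) := by
  induction k with
  | zero => simp
  | succ k ih =>
    refine ih.trans ?_
    have h : (1 : ℝ) ≤ 2 * ((2 * (n + k : ℕ) + 1) / (2 * (n + k : ℕ) + 2)) := by
      rw [← mul_div_assoc, one_le_div (by positivity)]
      have : (0 : ℝ) ≤ (n + k : ℕ) := Nat.cast_nonneg _
      linarith
    rw [← add_assoc, invSqrtCoeff_succ, pow_succ]
    have h0 : (0 : ℝ) ≤ 2 ^ k * invSqrtCoeff (n + k) :=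
      mul_nonneg (by positivity) (invSqrtCoeff_pos _).le
    nlinarith

theorem invSqrtCoeff_eq_choose (n : ℕ) :
    Ring.choose ((1 / 2 : ℝ) + n - 1) n = invSqrtCoeff n := by
  have key : ∀ n : ℕ, (n.factorial : ℝ) * invSqrtCoeff n =
      (ascPochhammer ℕ n).smeval (1 / 2 : ℝ) := by
    intro n
    induction n with
    | zero => simp [invSqrtCoeff]
    | succ n ih =>
      rw [ascPochhammer_succ_right, Polynomial.smeval_mul, ← ih, invSqrtCoeff_succ,
        Nat.factorial_succ]
      simp only [Polynomial.smeval_add, Polynomial.smeval_X, Polynomial.smeval_natCast]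
      push_cast
      simp
      field_simp
      ring
  have h := Ring.factorial_nsmul_multichoose_eq_ascPochhammer (1 / 2 : ℝ) n
  rw [← key, nsmul_eq_mul] at h
  rw [← Ring.multichoose_eq]
  exact mul_left_cancel₀ (by positivity) h

theorem hasSum_invSqrtCoeff {x : ℝ} (hx : |x| < 1) :
    HasSum (fun n => invSqrtCoeff n * x ^ n) (1 / √(1 - x)) := by
  have h := (Real.one_div_one_sub_rpow_hasFPowerSeriesOnBall_zero (1 / 2)).hasSum
    (y := x) (by simpa [enorm_eq_nnnorm, ← NNReal.coe_lt_one] using hx)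
  simpa [FormalMultilinearSeries.ofScalars_apply_eq, ← invSqrtCoeff_eq_choose,
    Real.sqrt_eq_rpow, mul_comm] using h

theorem wallis_eq (n : ℕ) : Real.Wallis.W n = ((2 * n + 1) * invSqrtCoeff n ^ 2)⁻¹ := by
  induction n with
  | zero => simp [Real.Wallis.W, invSqrtCoeff]
  | succ n ih =>
    have := (invSqrtCoeff_pos n).ne'
    rw [Real.Wallis.W_succ, ih, invSqrtCoeff_succ]
    push_cast
    field_simp
    ring

theorem tendsto_invSqrtCoeff_mul_sqrt :
    Tendsto (fun n : ℕ => invSqrtCoeff n * √(π * (n + 2 : ℕ))) atTop (nhds 1) := by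
  have hW : Tendsto Real.Wallis.W atTop (nhds (π / 2)) := Real.tendsto_prod_pi_div_two
  have hq : Tendsto (fun n : ℕ => ((n : ℝ) + 2) / (2 * n + 1)) atTop (nhds (1 / 2)) := by
    have h1 : Tendsto (fun n : ℕ => (3 / 4 : ℝ) * (1 / ((n : ℝ) + 1 / 2))) atTop (nhds 0) := by
      have := (tendsto_atTop_add_const_right atTop (1 / 2 : ℝ)
        tendsto_natCast_atTop_atTop).inv_tendsto_atTop.const_mul (3 / 4 : ℝ)
      simpa using this
    have h2 := h1.const_add (1 / 2 : ℝ)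
    rw [add_zero] at h2
    refine h2.congr fun n => ?_
    field_simp
    ring
  have h := ((hq.const_mul π).div hW (by positivity)).sqrt
  have he : √(π * (1 / 2) / (π / 2)) = 1 := by
    rw [show π * (1 / 2) / (π / 2) = 1 by field_simp, Real.sqrt_one]
  rw [he] at h
  refine h.congr fun n => ?_
  have hb := invSqrtCoeff_pos n
  have hs : invSqrtCoeff n * √(π * (n + 2 : ℕ)) =
      √(invSqrtCoeff n ^ 2 * (π * (n + 2 : ℕ))) := by
    rw [Real.sqrt_mul (sq_nonneg _), Real.sqrt_sq hb.le]
  rw [hs, Pi.div_apply, wallis_eq]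
  congr 1
  push_cast
  field_simp

theorem tendsto_invSqrtCoeff_add_div (k : ℕ) :
    Tendsto (fun n => invSqrtCoeff n / invSqrtCoeff (n + k)) atTop (nhds 1) := by
  induction k with
  | zero => simp [div_self (invSqrtCoeff_pos _).ne']
  | succ k ih =>
    have hr : Tendsto (fun n : ℕ => 1 + 1 / (2 * ((n + k : ℕ) : ℝ) + 1)) atTop (nhds 1) := by
      have h := ((tendsto_natCast_atTop_atTop (R := ℝ)).comp (tendsto_add_atTop_nat k))
      have h' := (tendsto_atTop_add_const_right atTop (1 : ℝ)
        (h.const_mul_atTop two_pos)).inv_tendsto_atTop.const_add (1 : ℝ)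
      simpa [Function.comp_def] using h'
    have h := ih.mul hr
    rw [mul_one] at h
    refine h.congr fun n => ?_
    have := (invSqrtCoeff_pos (n + k)).ne'
    rw [← add_assoc, invSqrtCoeff_succ]
    field_simp
    ring

/-- The central trinomial numbers, as the coefficients of the product of the series of
`(1 + z)^(-1/2)` and `(1 - 3 z)^(-1/2)`. -/
noncomputable def centralTrinom (n : ℕ) : ℝ :=
  ∑ k ∈ Finset.range (n + 1),
    (invSqrtCoeff k * (-1) ^ k) * (invSqrtCoeff (n - k) * 3 ^ (n - k))

theorem hasSum_centralTrinom {z : ℝ} (hz : |z| < 1 / 3) :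
    HasSum (fun n => centralTrinom n * z ^ n) (1 / √(1 - 2 * z - 3 * z ^ 2)) := by
  obtain ⟨hz1, hz2⟩ := abs_lt.mp hz
  have h1 : HasSum (fun n => invSqrtCoeff n * (-z) ^ n) _ :=
    hasSum_invSqrtCoeff (by rw [abs_neg]; linarith)
  have h2 : HasSum (fun n => invSqrtCoeff n * (3 * z) ^ n) _ :=
    hasSum_invSqrtCoeff (by rw [abs_mul, abs_of_pos three_pos]; linarith)
  have h := hasSum_sum_range_mul_of_summable_norm h1.summable.norm h2.summable.norm
  rw [h1.tsum_eq, h2.tsum_eq] at h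
  convert! h using 1
  · funext n
    rw [centralTrinom, Finset.sum_mul]
    refine Finset.sum_congr rfl fun k hk => ?_
    have hk' : k ≤ n := Nat.lt_succ_iff.mp (Finset.mem_range.mp hk)
    rw [neg_pow z, mul_pow]
    rw [show z ^ n = z ^ k * z ^ (n - k) by rw [← pow_add, Nat.add_sub_of_le hk']]
    ring
  · rw [one_div_mul_one_div, ← Real.sqrt_mul (by linarith)]
    ring_nf

theorem tendsto_centralTrinom_div :
    Tendsto (fun n => centralTrinom n / (3 ^ n * invSqrtCoeff n)) atTop (nhds (√3 / 2)) := by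
  have hsum : ∑' k, invSqrtCoeff k * (-1 / 3 : ℝ) ^ k = √3 / 2 := by
    rw [(hasSum_invSqrtCoeff (x := -1 / 3) (by norm_num [abs_lt])).tsum_eq,
      show (1 : ℝ) - -1 / 3 = 2 ^ 2 / 3 by norm_num, Real.sqrt_div (by norm_num),
      Real.sqrt_sq two_pos.le, one_div_div]
  rw [← hsum]
  let f : ℕ → ℕ → ℝ := fun n k => if k ∈ Finset.range (n + 1) then
    invSqrtCoeff k * (-1 / 3 : ℝ) ^ k * (invSqrtCoeff (n - k) / invSqrtCoeff n) else 0
  have hf : ∀ n, ∑' k, f n k = centralTrinom n / (3 ^ n * invSqrtCoeff n) := by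
    intro n
    rw [tsum_eq_sum (s := Finset.range (n + 1)) fun k hk => if_neg hk, centralTrinom,
      Finset.sum_div]
    refine Finset.sum_congr rfl fun k hk => ?_
    have hk' : k ≤ n := Nat.lt_succ_iff.mp (Finset.mem_range.mp hk)
    have := (invSqrtCoeff_pos n).ne'
    have h3 : (3 : ℝ) ^ n = 3 ^ k * 3 ^ (n - k) := by rw [← pow_add, Nat.add_sub_of_le hk']
    simp only [if_pos hk]
    rw [h3, div_pow]
    field_simp
  refine (tendsto_tsum_of_dominated_convergence (f := f)
    (bound := fun k => (2 / 3 : ℝ) ^ k)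
    (summable_geometric_of_lt_one (by norm_num) (by norm_num)) (fun k => ?_)
    (Eventually.of_forall fun n k => ?_)).congr hf
  · have h := (tendsto_invSqrtCoeff_add_div k).const_mul
      (invSqrtCoeff k * (-1 / 3 : ℝ) ^ k)
    rw [mul_one] at h
    rw [← tendsto_add_atTop_iff_nat k]
    refine h.congr fun n => ?_
    have hk : k ∈ Finset.range (n + k + 1) := Finset.mem_range.mpr (by lia)
    simp only [f, if_pos hk, Nat.add_sub_cancel]
  · by_cases hk : k ∈ Finset.range (n + 1)
    · have hk' : k ≤ n := Nat.lt_succ_iff.mp (Finset.mem_range.mp hk)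
      have hle := invSqrtCoeff_le_two_pow_mul (n - k) k
      rw [Nat.sub_add_cancel hk', ← div_le_iff₀ (invSqrtCoeff_pos n)] at hle
      have hq : 0 < invSqrtCoeff (n - k) / invSqrtCoeff n :=
        div_pos (invSqrtCoeff_pos _) (invSqrtCoeff_pos _)
      simp only [f, if_pos hk]
      rw [norm_mul, norm_mul, norm_pow, Real.norm_of_nonneg (invSqrtCoeff_pos k).le,
        Real.norm_of_nonneg hq.le, show ‖(-1 / 3 : ℝ)‖ = 1 / 3 by norm_num]
      calc invSqrtCoeff k * (1 / 3) ^ k * (invSqrtCoeff (n - k) / invSqrtCoeff n)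
          ≤ 1 * (1 / 3) ^ k * 2 ^ k := by
            gcongr
            exact invSqrtCoeff_le_one k
        _ = (2 / 3) ^ k := by rw [one_mul, ← mul_pow]; norm_num
    · simp only [f, if_neg hk, norm_zero]
      positivity

/-- A real power series is determined by its sums on a right neighbourhood of `0`. -/
theorem eq_of_hasSum_pow_of_pos {a c : ℕ → ℝ} {f : ℝ → ℝ} {r : ℝ} (hr : 0 < r)
    (ha : ∀ z, 0 < z → z < r → HasSum (fun n => a n * z ^ n) (f z))
    (hc : ∀ z, 0 < z → z < r → HasSum (fun n => c n * z ^ n) (f z)) : a = c := by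
  have hd : ∀ z, 0 < z → z < r → HasSum (fun n => (a n - c n) * z ^ n) 0 := fun z h0 h1 => by
    simpa [sub_mul] using (ha z h0 h1).sub (hc z h0 h1)
  set p := FormalMultilinearSeries.ofScalars ℝ fun n => a n - c n with hp
  have hrad : 0 < p.radius := by
    have h := (hd (r / 2) (by linarith) (by linarith)).summable.tendsto_atTop_zero
    let s : NNReal := ⟨r / 2, (half_pos hr).le⟩
    have hle : (s : ENNReal) ≤ p.radius := by
      refine p.le_radius_of_tendsto (l := 0) ?_
      refine (tendsto_zero_iff_norm_tendsto_zero.mp h).congr fun n => ?_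
      rw [hp, FormalMultilinearSeries.ofScalars_norm, norm_mul, norm_pow,
        Real.norm_of_nonneg (show 0 ≤ r / 2 by linarith)]
      rfl
    refine lt_of_lt_of_le ?_ hle
    rw [ENNReal.coe_pos, ← NNReal.coe_pos]
    exact half_pos hr
  have hps : HasFPowerSeriesAt p.sum p 0 := (p.hasFPowerSeriesOnBall hrad).hasFPowerSeriesAt
  have hzero : ∀ z, 0 < z → z < r → p.sum z = 0 := fun z h0 h1 => by
    rw [← (hd z h0 h1).tsum_eq]
    exact FormalMultilinearSeries.ofScalars_sum_eq (E := ℝ) (fun n => a n - c n) z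
  have hfreq : ∃ᶠ z in nhdsWithin (0 : ℝ) {0}ᶜ, p.sum z = 0 := by
    have hev : ∀ᶠ z in nhdsWithin (0 : ℝ) (Set.Ioi 0), p.sum z = 0 := by
      filter_upwards [Ioo_mem_nhdsGT hr] with z hz using hzero z hz.1 hz.2
    exact hev.frequently.filter_mono (nhdsWithin_mono _ fun z hz => ne_of_gt hz)
  have hp0 := hps.eq_zero_of_eventually
    (hps.analyticAt.frequently_zero_iff_eventually_zero.mp hfreq)
  rw [hp, FormalMultilinearSeries.ofScalars_series_eq_zero] at hp0
  exact funext fun n => sub_eq_zero.mp (congrFun hp0 n)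

theorem generatingFunction_eq {z : ℝ} (h0 : 0 < z) (h1 : z < 1 / 3) :
    (Vfun z) ^ 2 / ((1 - Vfun z) * (1 + Vfun z) ^ 2 * (1 + Vfun z + (Vfun z) ^ 2)) =
      z ^ 2 * (1 / 2 * (1 / √(1 - 2 * z - 3 * z ^ 2) + (1 + z)⁻¹)) := by
  have hpos : 0 < 1 - 2 * z - 3 * z ^ 2 := by nlinarith
  set S := √(1 - 2 * z - 3 * z ^ 2) with hS
  have hS0 : 0 < S := Real.sqrt_pos.mpr hpos
  have hS2 : S ^ 2 = 1 - 2 * z - 3 * z ^ 2 := Real.sq_sqrt hpos.le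
  have hV : Vfun z = (1 - z - S) / (2 * z) := rfl
  have hSlt : S < 1 - z := by nlinarith
  have hSgt : 1 - 3 * z < S := by nlinarith
  set v := Vfun z
  have hv0 : 0 < v := by rw [hV]; exact div_pos (by linarith) (by linarith)
  have hv1 : v < 1 := by rw [hV, div_lt_one (by linarith)]; linarith
  have hSv : S = 1 - z - 2 * z * v := by rw [hV]; field_simp; ring
  have hzv : z * (1 + v + v ^ 2) = v := by
    rw [hSv] at hS2
    have : z * (z * (1 + v + v ^ 2) - v) = 0 := by linarith
    linarith [(mul_eq_zero.mp this).resolve_left h0.ne']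
  have hq : 0 < 1 + v + v ^ 2 := by positivity
  have hz : z = v / (1 + v + v ^ 2) := by rw [eq_div_iff hq.ne', hzv]
  have hS' : S = (1 - v ^ 2) / (1 + v + v ^ 2) := by
    rw [hSv, hz]; field_simp; ring
  have h1v : 1 - v ≠ 0 := by linarith
  have h1v2 : 1 - v ^ 2 ≠ 0 := by nlinarith
  have h1z : 1 + z = (1 + v) ^ 2 / (1 + v + v ^ 2) := by rw [hz]; field_simp; ring
  rw [h1z, hS', hz, show 1 - v ^ 2 = (1 - v) * (1 + v) by ring]
  field_simp
  ring

theorem hasSum_generatingFunction {z : ℝ} (h0 : 0 < z) (h1 : z < 1 / 3) :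
    HasSum (fun n => (if n < 2 then 0 else
        1 / 2 * (centralTrinom (n - 2) + (-1) ^ (n - 2))) * z ^ n)
      ((Vfun z) ^ 2 /
        ((1 - Vfun z) * (1 + Vfun z) ^ 2 * (1 + Vfun z + (Vfun z) ^ 2))) := by
  have hg : HasSum (fun n : ℕ => (-z) ^ n) (1 + z)⁻¹ := by
    simpa using hasSum_geometric_of_abs_lt_one (r := -z)
      (by rw [abs_neg, abs_of_pos h0]; linarith)
  have ht := hasSum_centralTrinom (z := z) (by rwa [abs_of_pos h0])
  rw [generatingFunction_eq h0 h1, ← hasSum_nat_add_iff' 2]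
  convert! ((ht.add hg).mul_left (1 / 2)).mul_left (z ^ 2) using 1
  · funext n
    rw [if_neg (by lia), Nat.add_sub_cancel, neg_pow z, pow_add]
    ring
  · simp [Finset.sum_range_succ]

/-- If `a n` are power-series coefficients (in `z`) of
`v²/((1-v)(1+v)²(1+v+v²))` with `v = v(z)`, then
`a n ~ (√3/36)·3ⁿ/√(πn)` as `n → ∞`. -/
theorem coeff_asymptotics (a : ℕ → ℝ)
    (ha : ∀ z : ℝ, 0 < z → z < 1 / 3 →
      HasSum (fun n => a n * z ^ n)
        ((Vfun z) ^ 2 /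
          ((1 - Vfun z) * (1 + Vfun z) ^ 2 * (1 + Vfun z + (Vfun z) ^ 2)))) :
    Tendsto (fun n : ℕ =>
      a n / (Real.sqrt 3 / 36 * 3 ^ n / Real.sqrt (Real.pi * n)))
      atTop (nhds 1) := by

  have hcoeff := eq_of_hasSum_pow_of_pos (by norm_num) ha
    fun z h0 h1 => hasSum_generatingFunction h0 h1
  rw [← tendsto_add_atTop_iff_nat 2]
  have herr : Tendsto (fun n => (-1 / 3 : ℝ) ^ n / invSqrtCoeff n) atTop (nhds 0) := by
    refine squeeze_zero_norm (fun n => ?_)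
      (tendsto_pow_atTop_nhds_zero_of_lt_one (r := (2 / 3 : ℝ)) (by norm_num) (by norm_num))
    have h := invSqrtCoeff_le_two_pow_mul 0 n
    rw [zero_add, show invSqrtCoeff 0 = 1 by simp [invSqrtCoeff]] at h
    rw [norm_div, norm_pow, Real.norm_of_nonneg (invSqrtCoeff_pos n).le,
      show ‖(-1 / 3 : ℝ)‖ = 1 / 3 by norm_num, div_le_iff₀ (invSqrtCoeff_pos n),
      show (2 / 3 : ℝ) = 1 / 3 * 2 by norm_num, mul_pow, mul_assoc]
    exact le_mul_of_one_le_right (by positivity) h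
  have h := ((tendsto_centralTrinom_div.add herr).mul_const (2 / √3)).mul
    tendsto_invSqrtCoeff_mul_sqrt
  have h3 : √3 ≠ 0 := by positivity
  rw [show (√3 / 2 + 0) * (2 / √3) * 1 = 1 by field_simp; ring] at h
  refine h.congr fun n => ?_
  have hb := (invSqrtCoeff_pos n).ne'
  have hp : √(π * (n + 2 : ℕ)) ≠ 0 := by positivity
  have hs3 : √3 ^ 2 = 3 := Real.sq_sqrt (by norm_num)
  simp only [hcoeff]
  rw [if_neg (by lia), Nat.add_sub_cancel, div_pow, pow_add]
  field_simp
  ring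
end

section
/- The number of closed Deutsch paths of length n is asymptotic to (3√3/8)·3ⁿ/(√π · n^{3/2}) as n → ∞. -/
open Filter

def IsDeutsch (l : List ℤ) : Prop :=
  (∀ s ∈ l, s = 1 ∨ s ≤ -1) ∧ ∀ n : ℕ, 0 ≤ (l.take n).sum

noncomputable def deutschCount (n : ℕ) : ℕ :=
  Nat.card {l : List ℤ // IsDeutsch l ∧ l.length = n ∧ l.sum = 0}

/-- The Deutsch paths of length `n` from height `h` to height `0`. -/
noncomputable def deutschPaths : ℕ → ℕ → Finset (List ℤ)
  | 0, h => if h = 0 then {[]} else ∅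
  | n + 1, h =>
    (deutschPaths n (h + 1)).image (List.cons 1) ∪
      (Finset.range h).biUnion fun k => (deutschPaths n k).image (List.cons ((k : ℤ) - h))

theorem mem_deutschPaths {n h : ℕ} {l : List ℤ} :
    l ∈ deutschPaths n h ↔ (∀ s ∈ l, s = 1 ∨ s ≤ -1) ∧
      (∀ m : ℕ, 0 ≤ (h : ℤ) + (l.take m).sum) ∧ l.length = n ∧ (h : ℤ) + l.sum = 0 := by
  induction n generalizing h l with
  | zero =>
    rw [deutschPaths]
    split_ifs with hh
    · simp only [Finset.mem_singleton, List.length_eq_zero_iff]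
      constructor
      · rintro rfl
        simp [hh]
      · exact fun H => H.2.2.1
    · simp only [Finset.notMem_empty, List.length_eq_zero_iff, false_iff]
      rintro ⟨-, -, rfl, H⟩
      simp at H
      exact hh H
  | succ n ih =>
    rw [deutschPaths]
    simp only [Finset.mem_union, Finset.mem_image, Finset.mem_biUnion, Finset.mem_range, ih]
    constructor
    · rintro (⟨l, ⟨h1, h2, h3, h4⟩, rfl⟩ | ⟨k, hk, l, ⟨h1, h2, h3, h4⟩, rfl⟩)
      · refine ⟨by simpa using h1, ?_, by simp [h3], ?_⟩
        · rintro (_ | m)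
          · simp
          · have := h2 m
            simp only [List.take_succ_cons, List.sum_cons]
            push_cast at this
            lia
        · simp only [List.sum_cons]
          push_cast at h4
          lia
      · refine ⟨?_, ?_, by simp [h3], ?_⟩
        · simp only [List.mem_cons, forall_eq_or_imp]
          exact ⟨by lia, h1⟩
        · rintro (_ | m)
          · simp
          · have := h2 m
            simp only [List.take_succ_cons, List.sum_cons]
            lia
        · simp only [List.sum_cons]
          lia
    · rintro ⟨h1, h2, h3, h4⟩
      obtain _ | ⟨s, l⟩ := l
      · simp at h3
      simp only [List.mem_cons, forall_eq_or_imp] at h1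
      simp only [List.sum_cons] at h4
      simp only [List.length_cons, Nat.add_right_cancel_iff] at h3
      have h2' (m : ℕ) : 0 ≤ (h : ℤ) + (s + (l.take m).sum) := by simpa using h2 (m + 1)
      have hs : 0 ≤ (h : ℤ) + s := by simpa using h2' 0
      obtain ⟨rfl | hs1, h1⟩ := h1
      · refine Or.inl ⟨l, ⟨h1, fun m => ?_, h3, ?_⟩, rfl⟩
        · have := h2' m
          push_cast
          lia
        · push_cast
          lia
      · lift (h : ℤ) + s to ℕ using hs with k hk
        refine Or.inr ⟨k, by lia, l, ⟨h1, fun m => ?_, h3, ?_⟩, ?_⟩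
        · have := h2' m
          lia
        · lia
        · congr 1
          lia

theorem card_deutschPaths_succ (n h : ℕ) :
    (deutschPaths (n + 1) h).card =
      (deutschPaths n (h + 1)).card + ∑ k ∈ Finset.range h, (deutschPaths n k).card := by
  rw [deutschPaths, Finset.card_union_of_disjoint, Finset.card_biUnion]
  · simp only [Finset.card_image_of_injective _ List.cons_injective]
  · intro i _ j _ hij
    rw [Function.onFun, Finset.disjoint_left]
    simp only [Finset.mem_image, not_exists, not_and]
    rintro _ ⟨l, -, rfl⟩ l' - H
    have := (List.cons.inj H).1
    lia
  · rw [Finset.disjoint_left]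
    simp only [Finset.mem_image, Finset.mem_biUnion, Finset.mem_range, not_exists, not_and]
    rintro _ ⟨l, -, rfl⟩ k hk l' - H
    have := (List.cons.inj H).1
    lia

theorem deutschCount_eq_card_deutschPaths (n : ℕ) :
    deutschCount n = (deutschPaths n 0).card := by
  refine Nat.subtype_card _ fun l => ?_
  simp [mem_deutschPaths, IsDeutsch, and_assoc]

open Real intervalIntegral in
theorem integral_circleMap_mul_eq_zero {f : ℂ → ℂ} (hf : Differentiable ℂ f) :
    ∫ t in (0 : ℝ)..2 * π, circleMap 0 1 t * f (circleMap 0 1 t) = 0 := by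
  have h := (hf.diffContOnCl (s := Metric.ball 0 1)).circleIntegral_eq_zero zero_le_one
  simp only [circleIntegral, deriv_circleMap, smul_eq_mul, mul_right_comm _ Complex.I,
    integral_mul_const] at h
  simpa using h

/-- Polynomials whose moments against `1 + z + z⁻¹` on the unit circle count the Deutsch paths
starting at a given height. -/
noncomputable def deutschKernel : ℕ → ℂ → ℂ
  | 0, z => 1 - z
  | h + 1, z => z * ((1 - z) * (1 + z) ^ h)

theorem continuous_deutschKernel (h : ℕ) : Continuous (deutschKernel h) := by
  cases h <;> unfold deutschKernel <;> fun_prop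

theorem sum_deutschKernel (h : ℕ) (z : ℂ) :
    ∑ k ∈ Finset.range (h + 1), deutschKernel k z = (1 - z) * (1 + z) ^ h := by
  induction h with
  | zero => simp [deutschKernel]
  | succ h ih =>
    rw [Finset.sum_range_succ, ih, deutschKernel]
    ring

theorem mul_deutschKernel_succ (h : ℕ) {z : ℂ} (hz : z ≠ 0) :
    (1 + z + z⁻¹) * deutschKernel (h + 1) z =
      deutschKernel (h + 2) z + ∑ k ∈ Finset.range (h + 1), deutschKernel k z := by
  rw [sum_deutschKernel, deutschKernel, deutschKernel]
  field_simp
  ring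

theorem circleMap_zero_one_ne_zero (t : ℝ) : circleMap 0 1 t ≠ 0 :=
  circleMap_ne_center one_ne_zero

theorem one_add_circleMap_add_inv (t : ℝ) :
    1 + circleMap 0 1 t + (circleMap 0 1 t)⁻¹ = ((1 + 2 * Real.cos t : ℝ) : ℂ) := by
  simp only [circleMap, Complex.ofReal_one, one_mul, zero_add, ← Complex.exp_neg]
  push_cast
  rw [Complex.two_cos]
  ring_nf

theorem continuous_one_add_circleMap_add_inv_pow (n : ℕ) :
    Continuous fun t : ℝ => (1 + circleMap 0 1 t + (circleMap 0 1 t)⁻¹) ^ n := by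
  simp only [one_add_circleMap_add_inv]
  fun_prop

open Real intervalIntegral in
theorem integral_pow_mul_inv_sub_eq_zero (n : ℕ) :
    ∫ t in (0 : ℝ)..2 * π, (1 + circleMap 0 1 t + (circleMap 0 1 t)⁻¹) ^ n *
      ((circleMap 0 1 t)⁻¹ - circleMap 0 1 t) = 0 := by
  have hinv (t : ℝ) : circleMap 0 1 (2 * π - t) = (circleMap 0 1 t)⁻¹ := by
    simp only [circleMap, Complex.ofReal_one, one_mul, zero_add, ← Complex.exp_neg]
    push_cast
    rw [sub_mul, Complex.exp_sub, Complex.exp_two_pi_mul_I, one_div, Complex.exp_neg]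
  rw [← self_eq_neg, ← intervalIntegral.integral_neg]
  have hsub := integral_comp_sub_left (a := 0) (b := 2 * π)
    (fun t => (1 + circleMap 0 1 t + (circleMap 0 1 t)⁻¹) ^ n *
      ((circleMap 0 1 t)⁻¹ - circleMap 0 1 t)) (2 * π)
  rw [sub_self, sub_zero] at hsub
  rw [← hsub]
  refine integral_congr fun t _ => ?_
  simp only [hinv, inv_inv]
  ring

open Real intervalIntegral in
theorem integral_pow_mul_deutschKernel (n h : ℕ) :
    ∫ t in (0 : ℝ)..2 * π, (1 + circleMap 0 1 t + (circleMap 0 1 t)⁻¹) ^ n *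
      deutschKernel h (circleMap 0 1 t) = 2 * π * (deutschPaths n h).card := by
  have hint (n : ℕ) (f : ℂ → ℂ) (hf : Continuous f) : IntervalIntegrable
      (fun t => (1 + circleMap 0 1 t + (circleMap 0 1 t)⁻¹) ^ n * f (circleMap 0 1 t))
      MeasureTheory.volume 0 (2 * π) :=
    ((continuous_one_add_circleMap_add_inv_pow n).mul
      (hf.comp (continuous_circleMap 0 1))).intervalIntegrable _ _
  induction n generalizing h with
  | zero =>
    cases h with
    | zero =>
      have h0 := integral_circleMap_mul_eq_zero (f := fun _ => 1) (by fun_prop)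
      simp only [mul_one] at h0
      have hc : IntervalIntegrable (circleMap 0 1) MeasureTheory.volume 0 (2 * π) :=
        (continuous_circleMap 0 1).intervalIntegrable _ _
      simp [deutschKernel, deutschPaths, integral_sub _root_.intervalIntegrable_const hc, h0]
    | succ h =>
      have h0 := integral_circleMap_mul_eq_zero (f := fun z => (1 - z) * (1 + z) ^ h)
        (by fun_prop)
      simpa [deutschKernel, deutschPaths] using h0
  | succ n ih =>
    rw [card_deutschPaths_succ]
    push_cast
    rw [mul_add, Finset.mul_sum, ← ih]
    simp only [← ih]
    cases h with
    | zero =>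
      have hsub : IntervalIntegrable (fun t => (1 + circleMap 0 1 t + (circleMap 0 1 t)⁻¹) ^ n *
          ((circleMap 0 1 t)⁻¹ - circleMap 0 1 t)) MeasureTheory.volume 0 (2 * π) :=
        ((continuous_one_add_circleMap_add_inv_pow n).mul
          (((continuous_circleMap 0 1).inv₀ circleMap_zero_one_ne_zero).sub
            (continuous_circleMap 0 1))).intervalIntegrable _ _
      have hadd := integral_add (hint n _ (continuous_deutschKernel 1)) hsub
      rw [integral_pow_mul_inv_sub_eq_zero, add_zero] at hadd
      rw [Finset.sum_range_zero, add_zero, ← hadd]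
      refine integral_congr fun t _ => ?_
      have := circleMap_zero_one_ne_zero t
      simp only [deutschKernel, pow_succ]
      field_simp
      ring
    | succ h =>
      rw [← integral_finsetSum fun k _ => hint n _ (continuous_deutschKernel k)]
      simp only [← Finset.mul_sum]
      rw [← integral_add (hint n _ (continuous_deutschKernel _)) (hint n _
        (continuous_finsetSum _ fun k _ => continuous_deutschKernel k))]
      refine integral_congr fun t _ => ?_
      simp only [pow_succ, mul_assoc, ← mul_add,
        mul_deutschKernel_succ h (circleMap_zero_one_ne_zero t)]

open Real intervalIntegral in
theorem deutschCount_eq_integral (n : ℕ) :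
    (deutschCount n : ℝ) = (2 * π)⁻¹ * ∫ t in -π..π, (1 + 2 * cos t) ^ n * (1 - cos t) := by
  have hper : Function.Periodic (fun t => (1 + 2 * cos t) ^ n * (1 - cos t)) (2 * π) :=
    fun t => by simp only [cos_add_two_pi]
  have hshift := hper.intervalIntegral_add_eq 0 (-π)
  rw [zero_add, show -π + 2 * π = π by ring] at hshift
  rw [← hshift, deutschCount_eq_card_deutschPaths, eq_inv_mul_iff_mul_eq₀ (by positivity)]
  have h := congrArg Complex.reCLM (integral_pow_mul_deutschKernel n 0)
  rw [← ContinuousLinearMap.intervalIntegral_comp_comm] at h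
  · simp only [one_add_circleMap_add_inv, ← Complex.ofReal_pow, Complex.reCLM_apply,
      Complex.re_ofReal_mul, deutschKernel, Complex.sub_re, Complex.one_re] at h
    simp only [circleMap, Complex.ofReal_one, one_mul, zero_add, Complex.exp_ofReal_mul_I_re] at h
    rw [h]
    norm_cast
  · exact ((continuous_one_add_circleMap_add_inv_pow n).mul
      ((continuous_deutschKernel 0).comp (continuous_circleMap 0 1))).intervalIntegrable _ _

open Real in
theorem abs_one_add_two_mul_cos_div_three_le {x : ℝ} (hx : |x| ≤ π) :
    |(1 + 2 * cos x) / 3| ≤ exp (-(x ^ 2 / 10)) := by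
  have hpi : π ^ 2 < 10 := by nlinarith [pi_lt_d2, pi_pos]
  rw [abs_le]
  constructor
  · have hx2 : x ^ 2 ≤ π ^ 2 := sq_le_sq' (abs_le.1 hx).1 (abs_le.1 hx).2
    have h1 : exp (-1) ≤ exp (-(x ^ 2 / 10)) := exp_le_exp.2 (by linarith)
    have h2 : 1 / 3 ≤ exp (-1) := by
      rw [exp_neg, one_div]
      exact inv_anti₀ (exp_pos 1) exp_one_lt_three.le
    linarith [neg_one_le_cos x]
  · have h1 := cos_le_one_sub_mul_cos_sq hx
    have h2 : 1 / 5 ≤ 2 / π ^ 2 := by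
      rw [div_le_div_iff₀ (by norm_num) (by positivity)]
      linarith
    have h3 := mul_le_mul_of_nonneg_right h2 (sq_nonneg x)
    linarith [add_one_le_exp (-(x ^ 2 / 10)), sq_nonneg x]

open Real in
theorem one_sub_cos_eq_mul_sinc_sq (x : ℝ) : 1 - cos x = x ^ 2 / 2 * sinc (x / 2) ^ 2 := by
  rcases eq_or_ne x 0 with rfl | hx
  · simp
  · rw [sinc_of_ne_zero (by simpa using hx), div_pow, sin_sq_eq_half_sub]
    field_simp

open Real in
theorem tendsto_natCast_mul_one_sub_cos (s : ℝ) :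
    Tendsto (fun n : ℕ => (n : ℝ) * (1 - cos (s / √n))) atTop (nhds (s ^ 2 / 2)) := by
  have h0 : Tendsto (fun n : ℕ => s / √n / 2) atTop (nhds 0) := by
    simpa using (tendsto_const_nhds.div_atTop
      (tendsto_sqrt_atTop.comp tendsto_natCast_atTop_atTop)).div_const (2 : ℝ)
  have h1 : Tendsto (fun n : ℕ => s ^ 2 / 2 * sinc (s / √n / 2) ^ 2) atTop
      (nhds (s ^ 2 / 2)) := by
    simpa using (((continuous_sinc.tendsto 0).comp h0).pow 2).const_mul (s ^ 2 / 2)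
  refine h1.congr' ?_
  filter_upwards [eventually_gt_atTop 0] with n hn
  have hn' : (0 : ℝ) < n := by exact_mod_cast hn
  rw [one_sub_cos_eq_mul_sinc_sq, div_pow s, sq_sqrt hn'.le]
  field_simp

open Real in
theorem integrable_sq_mul_exp_neg_mul_sq {b : ℝ} (hb : 0 < b) :
    MeasureTheory.Integrable fun x : ℝ => x ^ 2 * exp (-b * x ^ 2) := by
  simpa using integrable_rpow_mul_exp_neg_mul_sq hb (s := 2) (by norm_num)

open Real in
theorem integral_sq_mul_exp_neg_mul_sq {b : ℝ} (hb : 0 < b) :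
    ∫ x : ℝ, x ^ 2 * exp (-b * x ^ 2) = √π / (2 * b * √b) := by
  have h1 := integral_comp_abs (f := fun x => x ^ 2 * exp (-b * x ^ 2))
  simp only [sq_abs] at h1
  have h2 := integral_rpow_mul_exp_neg_mul_rpow (p := 2) (q := 2) two_pos (by norm_num) hb
  have h3 : Gamma ((2 + 1) / 2) = √π / 2 := by
    have := Gamma_nat_add_half 1
    norm_num at this
    rw [← this]
    norm_num
  have h4 : b ^ (-(2 + 1) / 2 : ℝ) = (b * √b)⁻¹ := by
    rw [show (-(2 + 1) / 2 : ℝ) = -(1 + 1 / 2) by norm_num, rpow_neg hb.le, rpow_add hb, rpow_one,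
      ← sqrt_eq_rpow]
  simp only [rpow_two, h3, h4] at h2
  rw [h1, h2]
  field_simp

/-- The integrand of `deutschCount_eq_integral` after the substitution `t = s / √n`. -/
noncomputable def scaledIntegrand (n : ℕ) : ℝ → ℝ :=
  (Set.Ioc (-Real.pi * √n) (Real.pi * √n)).indicator fun s =>
    ((1 + 2 * Real.cos (s / √n)) / 3) ^ n * (n * (1 - Real.cos (s / √n)))

open Real in
theorem integral_scaledIntegrand {n : ℕ} (hn : 0 < n) :
    ∫ s, scaledIntegrand n s = n * √n * (2 * π) / 3 ^ n * deutschCount n := by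
  have hn' : (0 : ℝ) < n := by exact_mod_cast hn
  have hs : √(n : ℝ) ≠ 0 := by positivity
  have hle : -π * √n ≤ π * √n := by
    have := mul_nonneg pi_pos.le (sqrt_nonneg n)
    linarith
  rw [scaledIntegrand, MeasureTheory.integral_indicator measurableSet_Ioc,
    ← intervalIntegral.integral_of_le hle,
    intervalIntegral.integral_comp_div (fun t => ((1 + 2 * cos t) / 3) ^ n * (n * (1 - cos t))) hs,
    mul_div_cancel_right₀ _ hs, mul_div_cancel_right₀ _ hs, smul_eq_mul,
    deutschCount_eq_integral]
  have hfun (t : ℝ) : ((1 + 2 * cos t) / 3) ^ n * (n * (1 - cos t)) =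
      n / 3 ^ n * ((1 + 2 * cos t) ^ n * (1 - cos t)) := by
    rw [div_pow]
    ring
  simp only [hfun, intervalIntegral.integral_const_mul]
  field_simp

open Real in
theorem abs_scaledIntegrand_le (n : ℕ) (s : ℝ) :
    |scaledIntegrand n s| ≤ s ^ 2 * exp (-(1 / 10) * s ^ 2) := by
  rw [scaledIntegrand, Set.indicator_apply]
  split_ifs with h
  · rcases n.eq_zero_or_pos with rfl | hn
    · simp
      positivity
    have hn' : (0 : ℝ) < n := by exact_mod_cast hn
    have hs : 0 < √(n : ℝ) := by positivity
    have hx : |s / √n| ≤ π := by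
      rw [abs_div, abs_of_pos hs, div_le_iff₀ hs, abs_le]
      exact ⟨by linarith [h.1], h.2⟩
    have hsq : n * (s / √n) ^ 2 = s ^ 2 := by
      rw [div_pow, sq_sqrt hn'.le]
      field_simp
    have h1 : |((1 + 2 * cos (s / √n)) / 3) ^ n| ≤ exp (-(1 / 10) * s ^ 2) := by
      rw [abs_pow]
      refine (pow_le_pow_left₀ (abs_nonneg _) (abs_one_add_two_mul_cos_div_three_le hx) n).trans ?_
      rw [← exp_nat_mul, ← hsq]
      exact exp_le_exp.2 (by linarith)
    have h2 : |n * (1 - cos (s / √n))| ≤ s ^ 2 := by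
      rw [abs_of_nonneg (mul_nonneg hn'.le (sub_nonneg.2 (cos_le_one _))), ← hsq]
      refine mul_le_mul_of_nonneg_left ?_ hn'.le
      linarith [one_sub_sq_div_two_le_cos (x := s / √n), sq_nonneg (s / √n)]
    rw [abs_mul, mul_comm]
    gcongr
  · rw [abs_zero]
    positivity

open Real in
theorem tendsto_scaledIntegrand (s : ℝ) :
    Tendsto (fun n => scaledIntegrand n s) atTop
      (nhds (1 / 2 * (s ^ 2 * exp (-(1 / 3) * s ^ 2)))) := by
  have h1 := tendsto_natCast_mul_one_sub_cos s
  have h2 : Tendsto (fun n : ℕ => (1 + -(2 / 3) * (1 - cos (s / √n))) ^ n) atTop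
      (nhds (exp (-(2 / 3) * (s ^ 2 / 2)))) := by
    refine tendsto_one_add_pow_exp_of_tendsto ((h1.const_mul (-(2 / 3))).congr fun n => ?_)
    ring
  have h3 := h2.mul h1
  rw [show exp (-(2 / 3) * (s ^ 2 / 2)) * (s ^ 2 / 2) =
    1 / 2 * (s ^ 2 * exp (-(1 / 3) * s ^ 2)) by ring_nf] at h3
  refine h3.congr' ?_
  have hlarge : Tendsto (fun n : ℕ => π * √n) atTop atTop :=
    (tendsto_sqrt_atTop.comp tendsto_natCast_atTop_atTop).const_mul_atTop pi_pos
  filter_upwards [hlarge.eventually_gt_atTop |s|] with n hn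
  rw [abs_lt] at hn
  rw [scaledIntegrand, Set.indicator_of_mem (Set.mem_Ioc.2 ⟨by linarith [hn.1], hn.2.le⟩)]
  ring_nf

open Real in
theorem tendsto_integral_scaledIntegrand :
    Tendsto (fun n => ∫ s, scaledIntegrand n s) atTop (nhds (3 * √3 * √π / 4)) := by
  have hlim : ∫ s : ℝ, 1 / 2 * (s ^ 2 * exp (-(1 / 3) * s ^ 2)) = 3 * √3 * √π / 4 := by
    rw [MeasureTheory.integral_const_mul, integral_sq_mul_exp_neg_mul_sq (by norm_num), one_div 3,
      sqrt_inv]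
    field_simp
    norm_num
  rw [← hlim]
  refine MeasureTheory.tendsto_integral_of_dominated_convergence _ (fun n => ?_)
    (integrable_sq_mul_exp_neg_mul_sq (b := 1 / 10) (by norm_num))
    (fun n => .of_forall (abs_scaledIntegrand_le n)) (.of_forall tendsto_scaledIntegrand)
  exact ((by fun_prop : Measurable fun s : ℝ => ((1 + 2 * cos (s / √n)) / 3) ^ n *
    (n * (1 - cos (s / √n)))).indicator measurableSet_Ioc).aestronglyMeasurable

/-- The number of closed Deutsch paths of length `n` is asymptotic to
`(3√3/8)·3ⁿ/(√π·n^{3/2})`. -/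
theorem deutsch_count_asymptotics :
    Tendsto (fun n : ℕ =>
      (deutschCount n : ℝ) /
        (3 * Real.sqrt 3 / 8 * 3 ^ n / (Real.sqrt Real.pi * (n : ℝ) ^ ((3 : ℝ) / 2))))
      atTop (nhds 1) := by
  have h := tendsto_integral_scaledIntegrand.div_const (3 * √3 * √Real.pi / 4)
  rw [div_self (by positivity)] at h
  refine h.congr' ?_
  filter_upwards [eventually_gt_atTop 0] with n hn
  have hn' : (0 : ℝ) < n := by exact_mod_cast hn
  have hpow : (n : ℝ) ^ ((3 : ℝ) / 2) = n * √n := by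
    rw [show (3 : ℝ) / 2 = 1 + 1 / 2 by norm_num, Real.rpow_add hn', Real.rpow_one,
      ← Real.sqrt_eq_rpow]
  have hpi := Real.sq_sqrt Real.pi_pos.le
  rw [integral_scaledIntegrand hn, hpow]
  nth_rewrite 1 [← hpi]
  field_simp
  ring
end

section
/- The average number of maximal up-runs of length one in a uniformly random closed Deutsch path of length n is asymptotic to 2n/27 as n → ∞. -/
open Filter

def singleUpRuns (l : List ℤ) : ℕ :=
  ((Finset.range l.length).filter (fun i =>
    l.getD i 0 = 1 ∧ (i = 0 ∨ l.getD (i - 1) 0 ≠ 1) ∧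
    (i + 1 = l.length ∨ l.getD (i + 1) 0 ≠ 1))).card

/-- Total number of maximal up-runs of length one, summed over all closed
Deutsch paths of length `n` (encoded as the number of pairs `(l, m)` with
`m < singleUpRuns l`). -/
noncomputable def totalSingleUpRuns (n : ℕ) : ℕ :=
  Nat.card {p : List ℤ × ℕ // IsDeutsch p.1 ∧ p.1.length = n ∧ p.1.sum = 0 ∧
    p.2 < singleUpRuns p.1}

open PowerSeries

section Paths

/-- The paths with steps `1` and `-j`, `j ≥ 1`, of length `n` from height `h` to height `0` that
stay weakly above height `0`. -/
def pathsFrom : ℕ → ℕ → Finset (List ℤ)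
  | 0, h => if h = 0 then {[]} else ∅
  | n + 1, h => (pathsFrom n (h + 1)).image (List.cons 1) ∪
      (Finset.range h).biUnion fun k => (pathsFrom n k).image (List.cons ((k : ℤ) - h))

theorem mem_pathsFrom {n h : ℕ} {l : List ℤ} :
    l ∈ pathsFrom n h ↔ l.length = n ∧ (∀ s ∈ l, s = 1 ∨ s ≤ -1) ∧
      (∀ k : ℕ, 0 ≤ h + (l.take k).sum) ∧ h + l.sum = 0 := by
  induction n generalizing h l with
  | zero =>
    rw [pathsFrom, List.length_eq_zero_iff]
    split_ifs with hh
    · subst hh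
      simp only [Finset.mem_singleton]
      constructor
      · rintro rfl
        simp
      · exact And.left
    · simp only [Finset.notMem_empty, false_iff]
      rintro ⟨rfl, -, -, h0⟩
      simp at h0
      omega
  | succ n ih =>
    simp only [pathsFrom, Finset.mem_union, Finset.mem_image, Finset.mem_biUnion,
      Finset.mem_range]
    constructor
    · rintro (⟨l, hl, rfl⟩ | ⟨k, hk, l, hl, rfl⟩) <;> obtain ⟨h1, h2, h3, h4⟩ := ih.1 hl
      · refine ⟨by simp [h1], ?_, ?_, ?_⟩
        · simpa using h2
        · rintro (_ | k)
          · simp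
          · have := h3 k
            simp only [List.take_succ_cons, List.sum_cons]
            push_cast at this
            linarith
        · simp only [List.sum_cons]
          push_cast at h4
          linarith
      · refine ⟨by simp [h1], ?_, ?_, ?_⟩
        · simp only [List.mem_cons, forall_eq_or_imp]
          exact ⟨by right; omega, h2⟩
        · rintro (_ | j)
          · simp
          · have := h3 j
            simp only [List.take_succ_cons, List.sum_cons]
            linarith
        · simp only [List.sum_cons]
          linarith
    · rintro ⟨h1, h2, h3, h4⟩
      obtain _ | ⟨x, l⟩ := l
      · simp at h1
      have hx := h3 1
      simp only [List.take_succ_cons, List.take_zero, List.sum_cons, List.sum_nil,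
        List.mem_cons, forall_eq_or_imp, List.length_cons] at hx h1 h2 h4
      have h3' : ∀ k : ℕ, 0 ≤ h + (x + (l.take k).sum) := fun k => by simpa using h3 (k + 1)
      rcases h2.1 with rfl | hneg
      · refine Or.inl ⟨l, ih.2 ⟨by omega, h2.2, fun k => ?_, ?_⟩, rfl⟩
        · have := h3' k
          push_cast
          linarith
        · push_cast
          linarith
      · obtain ⟨k, hk⟩ := Int.eq_ofNat_of_zero_le (show 0 ≤ (h : ℤ) + x by linarith)
        refine Or.inr ⟨k, by omega, l, ih.2 ⟨by omega, h2.2, fun j => ?_, ?_⟩, ?_⟩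
        · have := h3' j
          linarith
        · linarith
        · congr 1
          linarith

theorem sum_pathsFrom_succ (f : List ℤ → ℝ) (n h : ℕ) :
    ∑ l ∈ pathsFrom (n + 1) h, f l = ∑ l ∈ pathsFrom n (h + 1), f (1 :: l) +
      ∑ k ∈ Finset.range h, ∑ l ∈ pathsFrom n k, f (((k : ℤ) - h) :: l) := by
  rw [pathsFrom, Finset.sum_union, Finset.sum_biUnion, Finset.sum_image]
  · congr 1
    refine Finset.sum_congr rfl fun k _ => Finset.sum_image ?_
    exact (List.cons_injective).injOn
  · exact (List.cons_injective).injOn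
  · intro a _ b _ hab
    simp only [Function.onFun, Finset.disjoint_left, Finset.mem_image]
    rintro _ ⟨l, -, rfl⟩ ⟨l', -, h'⟩
    simp only [List.cons.injEq, sub_left_inj, Nat.cast_inj] at h'
    exact hab h'.1.symm
  · simp only [Finset.disjoint_left, Finset.mem_image, Finset.mem_biUnion, Finset.mem_range]
    rintro _ ⟨l, -, rfl⟩ ⟨k, hk, l', -, h'⟩
    simp only [List.cons.injEq] at h'
    omega

theorem mem_pathsFrom_zero {n : ℕ} {l : List ℤ} :
    l ∈ pathsFrom n 0 ↔ IsDeutsch l ∧ l.length = n ∧ l.sum = 0 := by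
  rw [mem_pathsFrom]
  simp only [IsDeutsch, Nat.cast_zero, zero_add]
  tauto

theorem deutschCount_eq (n : ℕ) : deutschCount n = (pathsFrom n 0).card :=
  Nat.subtype_card _ fun _ => mem_pathsFrom_zero

theorem totalSingleUpRuns_eq (n : ℕ) :
    totalSingleUpRuns n = ∑ l ∈ pathsFrom n 0, singleUpRuns l := by
  rw [totalSingleUpRuns, Nat.subtype_card
    (((pathsFrom n 0).sigma fun l => Finset.range (singleUpRuns l)).map
      (Equiv.sigmaEquivProd (List ℤ) ℕ).toEmbedding)]
  · simp
  · rintro ⟨l, m⟩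
    simp only [Finset.mem_map_equiv, Equiv.sigmaEquivProd_symm_apply, Finset.mem_sigma,
      Finset.mem_range, mem_pathsFrom_zero]
    tauto

/-- Indicator of not starting with an up-step. -/
def noUpStart (l : List ℤ) : ℕ := if l.head? = some 1 then 0 else 1

/-- Indicator of starting with an up-run of length one. -/
def singleUpStart : List ℤ → ℕ
  | [] => 0
  | x :: l => if x = 1 then noUpStart l else 0

theorem singleUpRuns_eq_sum (l : List ℤ) :
    singleUpRuns l = ∑ i ∈ Finset.range l.length,
      if l.getD i 0 = 1 ∧ (i = 0 ∨ l.getD (i - 1) 0 ≠ 1) ∧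
        (i + 1 = l.length ∨ l.getD (i + 1) 0 ≠ 1) then 1 else 0 := by
  rw [singleUpRuns, Finset.card_filter]

theorem singleUpRuns_cons_of_ne {x : ℤ} (hx : x ≠ 1) (l : List ℤ) :
    singleUpRuns (x :: l) = singleUpRuns l := by
  rw [singleUpRuns_eq_sum, singleUpRuns_eq_sum, List.length_cons, Finset.sum_range_succ']
  simp only [List.getD_cons_zero, hx, false_and, if_false, add_zero]
  refine Finset.sum_congr rfl fun i _ => ?_
  obtain _ | i := i <;> simp [hx, eq_comm (a := 1) (b := l.length)]

theorem singleUpRuns_one_cons (l : List ℤ) :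
    singleUpRuns (1 :: l) + singleUpStart l = singleUpRuns l + noUpStart l := by
  obtain _ | ⟨y, l⟩ := l
  · simp [singleUpRuns, singleUpStart, noUpStart, Finset.filter_singleton]
  rw [singleUpRuns_eq_sum, singleUpRuns_eq_sum, List.length_cons, List.length_cons,
    Finset.sum_range_succ', Finset.sum_range_succ', Finset.sum_range_succ']
  by_cases hy : y = 1
  · subst hy
    obtain _ | ⟨w, l⟩ := l <;> simp [singleUpStart, noUpStart]
  · simp [singleUpStart, noUpStart, hy]

end Paths

section Series

/-- The generating function, by length, of the weight `f` on paths from height `h`. -/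
noncomputable def pathSeries (f : List ℤ → ℝ) (h : ℕ) : PowerSeries ℝ :=
  PowerSeries.mk fun n => ∑ l ∈ pathsFrom n h, f l

theorem pathSeries_eq {f g₁ g₂ : List ℤ → ℝ} (h₁ : ∀ l, f (1 :: l) = g₁ l)
    (h₂ : ∀ x l, x ≠ 1 → f (x :: l) = g₂ l) (h : ℕ) :
    pathSeries f h = (if h = 0 then C (f []) else 0) +
      X * (pathSeries g₁ (h + 1) + ∑ k ∈ Finset.range h, pathSeries g₂ k) := by
  ext (_ | n)
  · simp only [pathSeries, coeff_mk, pathsFrom, map_add, coeff_zero_X_mul]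
    split_ifs <;> simp
  · have : coeff (n + 1) (if h = 0 then C (f []) else 0) = 0 := by
      split_ifs <;> simp
    rw [map_add, this, coeff_succ_X_mul, map_add, map_sum, zero_add]
    simp only [pathSeries, coeff_mk, sum_pathsFrom_succ, h₁]
    congr 1
    refine Finset.sum_congr rfl fun k hk => Finset.sum_congr rfl fun l _ => h₂ _ _ ?_
    have := Finset.mem_range.1 hk
    omega

theorem pathSeries_add (f g : List ℤ → ℝ) (h : ℕ) :
    pathSeries (fun l => f l + g l) h = pathSeries f h + pathSeries g h := by
  ext n
  simp [pathSeries, Finset.sum_add_distrib]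

theorem pathSeries_sub (f g : List ℤ → ℝ) (h : ℕ) :
    pathSeries (fun l => f l - g l) h = pathSeries f h - pathSeries g h := by
  ext n
  simp [pathSeries, Finset.sum_sub_distrib]

theorem pathSeries_zero (h : ℕ) : pathSeries (fun _ => 0) h = 0 := by
  ext n
  simp [pathSeries]

/-- The recursion by first step has a unique solution. -/
theorem eq_of_firstStep {A B s : ℕ → PowerSeries ℝ}
    (hA : ∀ h, A h = s h + X * (A (h + 1) + ∑ k ∈ Finset.range h, A k))
    (hB : ∀ h, B h = s h + X * (B (h + 1) + ∑ k ∈ Finset.range h, B k)) : A = B := by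
  have key : ∀ n h, coeff n (A h) = coeff n (B h) := by
    intro n
    induction n with
    | zero => intro h; rw [hA, hB]; simp
    | succ n ih =>
      intro h
      rw [hA, hB]
      simp only [map_add, coeff_succ_X_mul, map_sum, ih]
  funext h
  ext n
  exact key n h

/-- The coefficients of the power series solution of `M = X (1 + M + M²)`. -/
noncomputable def motzkinCoeff : ℕ → ℝ
  | 0 => 0
  | n + 1 => (if n = 0 then 1 else 0) + motzkinCoeff n +
      ∑ i : Fin (n + 1), motzkinCoeff i * motzkinCoeff (n - i)

theorem exists_motzkinSeries :
    ∃ M : PowerSeries ℝ, constantCoeff M = 0 ∧ M = X * (1 + M + M ^ 2) := by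
  refine ⟨PowerSeries.mk motzkinCoeff, ?_, ?_⟩
  · rw [← coeff_zero_eq_constantCoeff_apply, coeff_mk, motzkinCoeff]
  · ext (_ | n)
    · simp [motzkinCoeff]
    · rw [coeff_succ_X_mul, coeff_mk, motzkinCoeff, map_add, map_add, coeff_one, coeff_mk,
        sq, coeff_mul, Finset.Nat.sum_antidiagonal_eq_sum_range_succ_mk,
        ← Fin.sum_univ_eq_sum_range
          (fun i => coeff i (PowerSeries.mk motzkinCoeff) *
            coeff (n - i) (PowerSeries.mk motzkinCoeff))]
      simp only [coeff_mk]

variable {M : PowerSeries ℝ}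

theorem sum_mul_one_add_pow (M : PowerSeries ℝ) (h : ℕ) :
    ∑ k ∈ Finset.range h, M * (1 + M) ^ k = (1 + M) ^ h - 1 := by
  induction h with
  | zero => simp
  | succ h ih => rw [Finset.sum_range_succ, ih]; ring

theorem pathSeries_one (hM : M = X * (1 + M + M ^ 2)) {W : PowerSeries ℝ} (hW : (1 + X) * W = 1)
    (h : ℕ) :
    pathSeries (fun _ => 1) h = (if h = 0 then W else 0) + W * (M * (1 + M) ^ h) := by
  refine congrFun (eq_of_firstStep (s := fun h => if h = 0 then 1 else 0)
    (B := fun h => (if h = 0 then W else 0) + W * (M * (1 + M) ^ h)) (fun h => ?_)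
    (fun h => ?_)) h
  · simpa using pathSeries_eq (f := fun _ => 1) (fun _ => rfl) (fun _ _ _ => rfl) h
  · rw [Finset.sum_add_distrib, ← Finset.mul_sum, sum_mul_one_add_pow]
    obtain _ | h := h
    · simp only [if_true, Finset.range_zero, Finset.sum_empty]
      simp
      linear_combination hW + W * hM
    · simp only [Finset.sum_ite_eq', Finset.mem_range]
      simp
      linear_combination W * (1 + M) ^ (h + 1) * hM

theorem pathSeries_noUpStart (hM : M = X * (1 + M + M ^ 2)) {W : PowerSeries ℝ}
    (hW : (1 + X) * W = 1) (h : ℕ) :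
    pathSeries (fun l => noUpStart l) (h + 1) = X * W * (1 + M) ^ (h + 1) := by
  rw [pathSeries_eq (g₁ := fun _ => 0) (g₂ := fun _ => 1) (by simp [noUpStart])
    (by simp +contextual [noUpStart]), pathSeries_zero]
  simp only [pathSeries_one hM hW]
  rw [Finset.sum_add_distrib, ← Finset.mul_sum, sum_mul_one_add_pow]
  simp only [Finset.sum_ite_eq', Finset.mem_range]
  simp
  ring

theorem pathSeries_singleUpStart (h : ℕ) :
    pathSeries (fun l => singleUpStart l) h = X * pathSeries (fun l => noUpStart l) (h + 1) := by
  rw [pathSeries_eq (g₁ := fun l => noUpStart l) (g₂ := fun _ => 0) (by simp [singleUpStart])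
    (by simp +contextual [singleUpStart])]
  simp [pathSeries_zero, singleUpStart]

theorem pathSeries_singleUpRuns (hM : M = X * (1 + M + M ^ 2)) {W Y : PowerSeries ℝ}
    (hW : (1 + X) * W = 1) (hY : (1 - M ^ 2) * Y = 1) (h : ℕ) :
    pathSeries (fun l => singleUpRuns l) h =
      X ^ 2 * W * Y * ((1 + M + (h : PowerSeries ℝ) * M) * (1 + M) ^ h) := by
  refine congrFun (eq_of_firstStep
    (s := fun h => X ^ 2 * W * (1 + M) ^ (h + 1) * (1 - X * (1 + M)))
    (A := fun h => pathSeries (fun l => singleUpRuns l) h)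
    (B := fun h => X ^ 2 * W * Y * ((1 + M + (h : PowerSeries ℝ) * M) * (1 + M) ^ h)) (fun h => ?_)
    (fun h => ?_)) h
  · rw [pathSeries_eq
      (g₁ := fun l => (singleUpRuns l + noUpStart l : ℝ) - singleUpStart l)
      (g₂ := fun l => singleUpRuns l)]
    · rw [pathSeries_sub, pathSeries_add, pathSeries_singleUpStart, pathSeries_noUpStart hM hW,
        pathSeries_noUpStart hM hW]
      simp [singleUpRuns]
      ring
    · intro l
      rw [eq_sub_iff_add_eq]
      exact_mod_cast singleUpRuns_one_cons l
    · intro x l hx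
      rw [singleUpRuns_cons_of_ne hx]
  · have hsum : ∑ k ∈ Finset.range h, ((1 + M + (k : PowerSeries ℝ) * M) * (1 + M) ^ k) = h * (1 + M) ^ h := by
      induction h with
      | zero => simp
      | succ h ih => rw [Finset.sum_range_succ, ih]; push_cast; ring
    rw [← Finset.mul_sum, hsum]
    push_cast
    linear_combination X ^ 2 * W * (1 + M) ^ h * Y * (h + (1 + M) * M) * hM +
      X ^ 2 * W * (1 + M) ^ (h + 1) * (1 - X * (1 + M)) * hY

theorem exists_mul_eq_one {φ : PowerSeries ℝ} (h : constantCoeff φ = 1) :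
    ∃ ψ : PowerSeries ℝ, φ * ψ = 1 :=
  ⟨φ⁻¹, PowerSeries.mul_inv_cancel φ (by simp [h])⟩

theorem exists_differential_relations :
    ∃ H W : PowerSeries ℝ, H = X * pathSeries (fun _ => 1) 0 ∧ (1 + X) * W = 1 ∧
      (1 + X) * (1 - 3 * X) * d⁄dX ℝ H + 2 * H = 1 ∧
      2 * pathSeries (fun l => singleUpRuns l) 0 = X ^ 2 * ((1 + X) * d⁄dX ℝ H + W) := by
  obtain ⟨M, hM0, hM⟩ := exists_motzkinSeries
  obtain ⟨W, hW⟩ := exists_mul_eq_one (φ := 1 + X) (by simp)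
  obtain ⟨I, hI⟩ := exists_mul_eq_one (φ := 1 + M) (by simp [hM0])
  obtain ⟨Z, hZ⟩ := exists_mul_eq_one (φ := 1 - M) (by simp [hM0])
  obtain ⟨J, hJ⟩ := exists_mul_eq_one (φ := 1 + M + M ^ 2) (by simp [hM0])
  have hX : X = M * J := by linear_combination -X * hJ - J * hM
  have hX1 : 1 + X = (1 + M) ^ 2 * J := by linear_combination hX - hJ
  have hX3 : 1 - 3 * X = (1 - M) ^ 2 * J := by linear_combination -3 * hX - hJ
  have hY : (1 - M ^ 2) * (I * Z) = 1 := by linear_combination (1 - M) * Z * hI + hZ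
  have hWI : W = I ^ 2 * (1 + M + M ^ 2) := by
    have h1 : (1 + X) * (I ^ 2 * (1 + M + M ^ 2)) = 1 := by
      rw [hX1]
      linear_combination ((1 + M) * I) ^ 2 * hJ + ((1 + M) * I + 1) * hI
    linear_combination -W * h1 + I ^ 2 * (1 + M + M ^ 2) * hW
  have hH : X * pathSeries (fun _ => 1) 0 = M * I := by
    rw [pathSeries_one hM hW, hWI, hX]
    simp only [if_true]
    linear_combination M * I ^ 2 * (1 + M) * hJ + M * I * hI
  have hM' : d⁄dX ℝ M = I * Z * (1 + M + M ^ 2) ^ 2 := by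
    have h1 := congrArg (d⁄dX ℝ) hM
    simp only [Derivation.leibniz, Derivation.leibniz_pow, map_add, derivative_X,
      Derivation.map_one_eq_zero, smul_eq_mul, nsmul_eq_mul] at h1
    norm_num at h1
    have h2 : d⁄dX ℝ M * (1 - M ^ 2) = (1 + M + M ^ 2) ^ 2 := by
      linear_combination (1 + M + M ^ 2) * h1 - (1 + 2 * M) * d⁄dX ℝ M * hM
    linear_combination I * Z * h2 - d⁄dX ℝ M * hY
  have hH' : d⁄dX ℝ (M * I) = I ^ 2 * d⁄dX ℝ M := by
    have h1 := congrArg (d⁄dX ℝ) hI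
    simp only [Derivation.leibniz, map_add,
      Derivation.map_one_eq_zero, smul_eq_mul, zero_add] at h1 ⊢
    have h2 : d⁄dX ℝ I = -I ^ 2 * d⁄dX ℝ M := by
      linear_combination I * h1 - d⁄dX ℝ I * hI
    rw [h2]
    linear_combination -I * d⁄dX ℝ M * hI
  refine ⟨M * I, W, hH.symm, hW, ?_, ?_⟩
  · rw [hH', hM', hX1, hX3]
    linear_combination (1 - M) * I * (((1 + M + M ^ 2) * J + 1) * ((1 + M) * I) ^ 2 *
      ((1 - M) * Z) * hJ + ((1 + M) * I + 1) * ((1 - M) * Z) * hI + hZ) + hI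
  · rw [pathSeries_singleUpRuns hM hW hY, hH', hM', hX1, hWI]
    push_cast
    linear_combination X ^ 2 * (1 + M + M ^ 2) * (2 * I ^ 2 * Z * hI -
      I * Z * ((1 + M) * I) ^ 2 * hJ - I * Z * ((1 + M) * I + 1) * hI + I * Z * hI + I ^ 2 * hZ)

end Series

section Recurrence

/-- `deutschCount` as a real sequence. -/
noncomputable def deutschReal (n : ℕ) : ℝ := deutschCount n

theorem coeff_pathSeries_one (n : ℕ) : coeff n (pathSeries (fun _ => 1) 0) = deutschReal n := by
  simp [pathSeries, deutschReal, deutschCount_eq]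

theorem coeff_pathSeries_singleUpRuns (n : ℕ) :
    coeff n (pathSeries (fun l => singleUpRuns l) 0) = totalSingleUpRuns n := by
  simp [pathSeries, totalSingleUpRuns_eq]

theorem deutschReal_initial_and_recurrence :
    deutschReal 0 = 1 ∧ deutschReal 1 = 0 ∧ ∀ n : ℕ,
      (n + 3) * deutschReal (n + 2) = (n + 1) * (2 * deutschReal (n + 1) + 3 * deutschReal n) := by
  obtain ⟨H, W, hH, -, h, -⟩ := exists_differential_relations
  have h' : d⁄dX ℝ H + (H + H) = 1 + X * (d⁄dX ℝ H + d⁄dX ℝ H) +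
      X * (X * (d⁄dX ℝ H + d⁄dX ℝ H + d⁄dX ℝ H)) := by
    linear_combination h
  have c0 : coeff 0 H = 0 := by rw [hH, coeff_zero_X_mul]
  have c (n : ℕ) : coeff (n + 1) H = deutschReal n := by
    rw [hH, coeff_succ_X_mul, coeff_pathSeries_one]
  have e0 : deutschReal 0 = 1 := by
    have := congrArg (coeff 0) h'
    simp only [map_add, coeff_zero_X_mul, coeff_derivative, c, c0, coeff_zero_one] at this
    norm_num at this
    exact this
  refine ⟨e0, ?_, fun n => ?_⟩
  · have := congrArg (coeff (0 + 1)) h'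
    simp only [map_add, coeff_succ_X_mul, coeff_zero_X_mul, coeff_derivative, c, coeff_one]
      at this
    norm_num at this
    linarith
  · have := congrArg (coeff (n + 1 + 1)) h'
    simp only [map_add, coeff_succ_X_mul, coeff_derivative, c, coeff_one] at this
    norm_num at this
    linear_combination this

theorem exists_totalSingleUpRuns_eq :
    ∃ w : ℕ → ℝ, (∀ n, |w n| ≤ 1) ∧ ∀ n : ℕ, 2 * (totalSingleUpRuns (n + 3) : ℝ) =
      (n + 2) * deutschReal (n + 1) + (n + 1) * deutschReal n + w n := by
  obtain ⟨H, W, hH, hW, -, h⟩ := exists_differential_relations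
  have c (n : ℕ) : coeff (n + 1) H = deutschReal n := by
    rw [hH, coeff_succ_X_mul, coeff_pathSeries_one]
  have hW' : W + X * W = 1 := by linear_combination hW
  have hw (n : ℕ) : |coeff n W| ≤ 1 := by
    induction n with
    | zero =>
      have := congrArg (coeff 0) hW'
      rw [map_add, coeff_zero_X_mul, coeff_zero_one, add_zero] at this
      simp only [this, abs_one, le_refl]
    | succ n ih =>
      have := congrArg (coeff (n + 1)) hW'
      rw [map_add, coeff_succ_X_mul, coeff_one, if_neg n.succ_ne_zero] at this
      rwa [eq_neg_of_add_eq_zero_left this, abs_neg]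
  refine ⟨fun n => coeff (n + 1) W, fun n => hw _, fun n => ?_⟩
  have h' : pathSeries (fun l => singleUpRuns l) 0 + pathSeries (fun l => singleUpRuns l) 0 =
      X * (X * (d⁄dX ℝ H + X * d⁄dX ℝ H + W)) := by
    linear_combination h
  have := congrArg (coeff (n + 1 + 1 + 1)) h'
  simp only [map_add, coeff_succ_X_mul, coeff_derivative, c,
    coeff_pathSeries_singleUpRuns] at this
  push_cast at this
  linear_combination this

theorem deutschReal_bounds (n : ℕ) : 0 < deutschReal (n + 2) ∧
    deutschReal (n + 3) ≤ 3 * deutschReal (n + 2) ∧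
    3 * (n + 3) * deutschReal (n + 2) ≤ (n + 9) * deutschReal (n + 3) := by
  obtain ⟨h0, h1, hr⟩ := deutschReal_initial_and_recurrence
  induction n with
  | zero =>
    have h2 := hr 0
    have h3 := hr 1
    norm_num [h0, h1] at h2 h3 ⊢
    rw [h2] at h3 ⊢
    norm_num at h3 ⊢
    constructor <;> linarith
  | succ n ih =>
    obtain ⟨hpos, hle, hge⟩ := ih
    have h4 : (((n + 2 : ℕ) : ℝ) + 3) * deutschReal (n + 4) = (((n + 2 : ℕ) : ℝ) + 1) *
      (2 * deutschReal (n + 3) + 3 * deutschReal (n + 2)) := hr (n + 2)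
    change 0 < deutschReal (n + 3) ∧ deutschReal (n + 4) ≤ 3 * deutschReal (n + 3) ∧
      3 * (((n + 1 : ℕ) : ℝ) + 3) * deutschReal (n + 3) ≤
        (((n + 1 : ℕ) : ℝ) + 9) * deutschReal (n + 4)
    generalize deutschReal (n + 2) = a at *
    generalize deutschReal (n + 3) = b at *
    generalize deutschReal (n + 4) = c at *
    push_cast at h4 ⊢
    have hn : (0 : ℝ) ≤ n := n.cast_nonneg
    have hb : 0 < b := by
      refine pos_of_mul_pos_right (lt_of_lt_of_le ?_ hge) (by positivity)
      positivity
    refine ⟨hb, ?_, ?_⟩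
    · refine le_of_mul_le_mul_left ?_ (show (0 : ℝ) < n + 5 by positivity)
      linarith
    · refine le_of_mul_le_mul_left ?_ (show (0 : ℝ) < n + 5 by positivity)
      have h5 := mul_le_mul_of_nonneg_left hle (show (0 : ℝ) ≤ (n + 10) * (n + 3) by positivity)
      have h6 : 0 ≤ (4 * n + 10) * b := by positivity
      linear_combination h5 + 3 * h6 - (n + 10) * h4

theorem tendsto_natCast_add_div_add (a b : ℝ) :
    Tendsto (fun n : ℕ => ((n : ℝ) + a) / (n + b)) atTop (nhds 1) := by
  simpa [add_comm] using tendsto_add_mul_div_add_mul_atTop_nhds a b (1 : ℝ) one_ne_zero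

theorem tendsto_deutschReal_ratio :
    Tendsto (fun n => deutschReal (n + 1) / deutschReal n) atTop (nhds 3) := by
  rw [← tendsto_add_atTop_iff_nat 2]
  refine tendsto_of_tendsto_of_tendsto_of_le_of_le (g := fun n : ℕ => 3 * (((n : ℝ) + 3) / (n + 9)))
    (h := fun _ => 3) ?_ tendsto_const_nhds (fun n => ?_) fun n => ?_
  · simpa using (tendsto_natCast_add_div_add 3 9).const_mul (3 : ℝ)
  · obtain ⟨hpos, -, h⟩ := deutschReal_bounds n
    dsimp only
    rw [← mul_div_assoc, div_le_div_iff₀ (by positivity) hpos]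
    linarith
  · obtain ⟨hpos, h, -⟩ := deutschReal_bounds n
    exact (div_le_iff₀ hpos).2 h

end Recurrence

/-- The average number of maximal up-runs of length one in a random closed
Deutsch path of length `n` is asymptotic to `2n/27`. -/
theorem average_single_up_runs :
    Tendsto (fun n : ℕ =>
      ((totalSingleUpRuns n : ℝ) / (deutschCount n : ℝ)) / (2 * n / 27))
      atTop (nhds 1) := by
  obtain ⟨w, hw, hT⟩ := exists_totalSingleUpRuns_eq
  set ρ : ℕ → ℝ := fun n => deutschReal (n + 1) / deutschReal n with hρ
  have hρk (k : ℕ) : Tendsto (fun n => ρ (n + k)) atTop (nhds 3) :=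
    (tendsto_add_atTop_iff_nat k).2 tendsto_deutschReal_ratio
  have hw0 : Tendsto (fun n : ℕ => w (n + 2) / (((n : ℝ) + 5) * deutschReal (n + 5)))
      atTop (nhds 0) := by
    refine squeeze_zero_norm (a := fun n : ℕ => 1 / ((n : ℝ) + 1)) (fun n => ?_)
      tendsto_one_div_add_atTop_nhds_zero_nat
    have hone : 1 ≤ deutschReal (n + 5) := by
      exact Nat.one_le_cast.2 (Nat.cast_pos.1 (deutschReal_bounds (n + 3)).1)
    rw [Real.norm_eq_abs, abs_div, abs_of_pos (show 0 < ((n : ℝ) + 5) * deutschReal (n + 5) by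
      positivity)]
    refine div_le_div₀ zero_le_one (hw _) (by positivity) ?_
    nlinarith [(n.cast_nonneg : (0 : ℝ) ≤ n)]
  have hlim : Tendsto (fun n : ℕ => 27 / 4 *
      (((n : ℝ) + 4) / (n + 5) * (ρ (n + 4) * ρ (n + 3))⁻¹ +
        ((n : ℝ) + 3) / (n + 5) * (ρ (n + 4) * ρ (n + 3) * ρ (n + 2))⁻¹ +
        w (n + 2) / (((n : ℝ) + 5) * deutschReal (n + 5)))) atTop (nhds 1) := by
    have := (((tendsto_natCast_add_div_add 4 5).mul
      (((hρk 4).mul (hρk 3)).inv₀ (by norm_num))).add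
        ((tendsto_natCast_add_div_add 3 5).mul
          ((((hρk 4).mul (hρk 3)).mul (hρk 2)).inv₀ (by norm_num)))).add hw0
    convert this.const_mul (27 / 4 : ℝ) using 2
    norm_num
  rw [← tendsto_add_atTop_iff_nat 5]
  refine hlim.congr fun n => ?_
  have h2 : deutschReal (n + 2) ≠ 0 := (deutschReal_bounds n).1.ne'
  have h3 : deutschReal (n + 3) ≠ 0 := (deutschReal_bounds (n + 1)).1.ne'
  have h4 : deutschReal (n + 4) ≠ 0 := (deutschReal_bounds (n + 2)).1.ne'
  have h5 : deutschReal (n + 5) ≠ 0 := (deutschReal_bounds (n + 3)).1.ne'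
  have hn : (n : ℝ) + 5 ≠ 0 := by positivity
  have hTn : (totalSingleUpRuns (n + 5) : ℝ) =
      ((n + 4) * deutschReal (n + 3) + (n + 3) * deutschReal (n + 2) + w (n + 2)) / 2 := by
    have := hT (n + 2)
    push_cast at this
    linear_combination this / 2
  rw [hTn]
  change _ = _ / deutschReal (n + 5) / _
  simp only [hρ, add_assoc, Nat.reduceAdd]
  push_cast
  field_simp
  ring
end
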